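/- For all partitions λ, μ, in ℚ(q1,q2,z): if c is an addable cell of λ then Ñ_{λ∪{c},μ}(z) = Y_μ(q3^{−1} z χ_c) · Ñ_{λ,μ}(z), and if c' is an addable cell of μ then Ñ_{λ,μ∪{c'}}(z) = Y_λ(χ_{c'}/z) · Ñ_{λ,μ}(z). -/

import Mathlib

open scoped BigOperators

noncomputable section

/-- The field `ℚ(q1, q2, z)` of rational functions in three independent indeterminates. -/
abbrev K : Type := FractionRing (MvPolynomial (Fin 3) ℚ)

/-- The indeterminate `q1`. -/
def q1 : K := algebraMap (MvPolynomial (Fin 3) ℚ) K (MvPolynomial.X 0)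

/-- The indeterminate `q2`. -/
def q2 : K := algebraMap (MvPolynomial (Fin 3) ℚ) K (MvPolynomial.X 1)

/-- The indeterminate `z`. -/
def z : K := algebraMap (MvPolynomial (Fin 3) ℚ) K (MvPolynomial.X 2)

/-- `q3 = (q1 q2)⁻¹`. -/
def q3 : K := (q1 * q2)⁻¹

/-- Box content `χ_c = q1^(i-1) * q2^(j-1)` of the 1-indexed cell `(i,j)`.
Here cells of a `YoungDiagram` are 0-indexed, so the cell `c` corresponding to the
1-indexed cell `(i,j)` is `c = (i-1, j-1)` and `χ_c = q1^c.1 * q2^c.2`. -/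
def chi (c : ℕ × ℕ) : K := q1 ^ c.1 * q2 ^ c.2

/-- `c` is an addable cell of the Young diagram `d`: it is not a cell of `d` and adjoining
it again gives (the cells of) a Young diagram. -/
def IsAddable (d : YoungDiagram) (c : ℕ × ℕ) : Prop :=
  c ∉ d.cells ∧ IsLowerSet (↑(insert c d.cells) : Set (ℕ × ℕ))

/-- `c` is a removable cell of the Young diagram `d`: it is a cell of `d` and deleting
it again gives (the cells of) a Young diagram. -/
def IsRemovable (d : YoungDiagram) (c : ℕ × ℕ) : Prop :=
  c ∈ d.cells ∧ IsLowerSet (↑(d.cells.erase c) : Set (ℕ × ℕ))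

open Classical in
/-- The (finite) set `A(d)` of addable cells of `d`; every addable cell `(i,j)` satisfies
`i ≤ colLen 0` and `j ≤ rowLen 0`, so filtering the bounding box captures all of them. -/
noncomputable def addables (d : YoungDiagram) : Finset (ℕ × ℕ) :=
  (Finset.range (d.colLen 0 + 1) ×ˢ Finset.range (d.rowLen 0 + 1)).filter (IsAddable d)

open Classical in
/-- The (finite) set `R(d)` of removable cells of `d`. -/
noncomputable def removables (d : YoungDiagram) : Finset (ℕ × ℕ) :=
  d.cells.filter (IsRemovable d)

/-- The Young diagram `λ ∪ {c}` obtained by adjoining an addable cell `c` to `λ`. -/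
def addCell (d : YoungDiagram) (c : ℕ × ℕ)
    (h : IsLowerSet (↑(insert c d.cells) : Set (ℕ × ℕ))) : YoungDiagram :=
  ⟨insert c d.cells, h⟩

/-- The (K-theoretic) Nekrasov factor
`N_{λ,μ}(w) = ∏_{(i,j)∈λ} (1 − w q1^{λ^T_j − i + 1} q2^{j − μ_i})`
`           · ∏_{(i,j)∈μ} (1 − w q1^{i − μ^T_j} q2^{λ_i − j + 1})`
written in terms of 0-indexed cells (`λ^T_j = colLen (j-1)`, `λ_i = rowLen (i-1)`). -/
def nek (lam mu : YoungDiagram) (w : K) : K :=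
  (∏ c ∈ lam.cells,
      (1 - w * q1 ^ ((lam.colLen c.2 : ℤ) - (c.1 : ℤ)) *
        q2 ^ ((c.2 : ℤ) + 1 - (mu.rowLen c.1 : ℤ)))) *
    ∏ c ∈ mu.cells,
      (1 - w * q1 ^ ((c.1 : ℤ) + 1 - (mu.colLen c.2 : ℤ)) *
        q2 ^ ((lam.rowLen c.1 : ℤ) - (c.2 : ℤ)))

/-- The modified Nekrasov factor `Ñ_{λ,μ}(w) = N_{λ,μ}(w) · ∏_{c∈λ} (−q3⁻¹ w χ_c)⁻¹`. -/
def nekT (lam mu : YoungDiagram) (w : K) : K :=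
  nek lam mu w * (∏ c ∈ lam.cells, (-q3⁻¹ * w * chi c))⁻¹

/-- `Y_λ(w) = ∏_{c∈A(λ)} (1 − χ_c/w) / ∏_{c∈R(λ)} (1 − χ_c/(q3 w))`. -/
def Ycal (d : YoungDiagram) (w : K) : K :=
  (∏ c ∈ addables d, (1 - chi c / w)) / ∏ c ∈ removables d, (1 - chi c / (q3 * w))


theorem q1ne : q1 ≠ 0 := by
  unfold q1
  rw [Ne, FaithfulSMul.algebraMap_eq_zero_iff]
  exact MvPolynomial.X_ne_zero _

theorem q2ne : q2 ≠ 0 := by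
  unfold q2
  rw [Ne, FaithfulSMul.algebraMap_eq_zero_iff]
  exact MvPolynomial.X_ne_zero _

theorem zne0 : z ≠ 0 := by
  unfold z
  rw [Ne, FaithfulSMul.algebraMap_eq_zero_iff]
  exact MvPolynomial.X_ne_zero _

theorem zne (m n : ℤ) : 1 - z * q1 ^ m * q2 ^ n ≠ 0 := by
  intro h
  have e : ∀ m : ℤ, ∃ a b : ℕ, m = a - b := fun m => ⟨m.toNat, (-m).toNat, by omega⟩
  obtain ⟨a, b, rfl⟩ := e m
  obtain ⟨c, d, rfl⟩ := e n
  rw [zpow_sub₀ q1ne, zpow_sub₀ q2ne] at h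
  simp only [zpow_natCast] at h
  have h1 := q1ne
  have h2 := q2ne
  field_simp at h
  have h3 : q1 ^ b * q2 ^ d = z * q1 ^ a * q2 ^ c := by linear_combination h
  unfold q1 q2 z at h3
  simp only [← map_pow, ← map_mul] at h3
  have h4 := FaithfulSMul.algebraMap_injective _ _ h3
  have h5 := congrArg (MvPolynomial.eval (fun i : Fin 3 => if i = 2 then (0 : ℚ) else 1)) h4
  simp at h5

theorem isAddable_iff (d : YoungDiagram) (i j : ℕ) :
    IsAddable d (i, j) ↔ j = d.rowLen i ∧ (i = 0 ∨ d.rowLen i < d.rowLen (i - 1)) := by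
  constructor
  · rintro ⟨h1, h2⟩
    have h1' : d.rowLen i ≤ j := by
      rw [YoungDiagram.mem_cells, YoungDiagram.mem_iff_lt_rowLen] at h1; omega
    have key : ∀ a b, a ≤ i → b ≤ j → (a, b) ≠ (i, j) → b < d.rowLen a := by
      intro a b ha hb hne
      have := h2 (show (a, b) ≤ (i, j) from ⟨ha, hb⟩) (by simp)
      rw [Finset.mem_coe, Finset.mem_insert, YoungDiagram.mem_cells,
        YoungDiagram.mem_iff_lt_rowLen] at this
      tauto
    have hj : j = d.rowLen i := by
      rcases Nat.eq_zero_or_pos j with h | h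
      · omega
      · have := key i (j - 1) le_rfl (by omega) (by simp; omega)
        omega
    refine ⟨hj, ?_⟩
    rcases Nat.eq_zero_or_pos i with h | h
    · exact Or.inl h
    · right
      have := key (i - 1) j (by omega) le_rfl (by simp; omega)
      omega
  · rintro ⟨rfl, h⟩
    refine ⟨by simp [YoungDiagram.mem_iff_lt_rowLen], ?_⟩
    rintro ⟨a, b⟩ ⟨a', b'⟩ hle hm
    have h1 : a' ≤ a := hle.1
    have h2 : b' ≤ b := hle.2
    rw [Finset.mem_coe, Finset.mem_insert, YoungDiagram.mem_cells,
        YoungDiagram.mem_iff_lt_rowLen] at hm ⊢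
    rcases hm with hm | hm
    · obtain ⟨rfl, rfl⟩ := Prod.mk.inj hm
      by_cases e : a' = a
      · subst e
        by_cases e2 : b' = d.rowLen a'
        · left; rw [e2]
        · right; omega
      · right
        have := d.rowLen_anti a' (a - 1) (by omega)
        omega
    · right
      have := d.rowLen_anti a' a h1
      omega

theorem isRemovable_iff (d : YoungDiagram) (i j : ℕ) :
    IsRemovable d (i, j) ↔ j + 1 = d.rowLen i ∧ d.rowLen (i + 1) < d.rowLen i := by
  constructor
  · rintro ⟨h1, h2⟩
    rw [YoungDiagram.mem_cells, YoungDiagram.mem_iff_lt_rowLen] at h1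
    have key : ∀ a b, i ≤ a → j ≤ b → (a, b) ≠ (i, j) → d.rowLen a ≤ b := by
      intro a b ha hb hne
      by_contra hc
      have := h2 (show (i, j) ≤ (a, b) from ⟨ha, hb⟩) (by
        rw [Finset.mem_coe, Finset.mem_erase, YoungDiagram.mem_cells,
          YoungDiagram.mem_iff_lt_rowLen]
        exact ⟨hne, by omega⟩)
      simp at this
    have := key i (j + 1) le_rfl (by omega) (by simp)
    have := key (i + 1) j (by omega) le_rfl (by simp)
    omega
  · rintro ⟨h, h'⟩
    refine ⟨by rw [YoungDiagram.mem_cells, YoungDiagram.mem_iff_lt_rowLen]; omega, ?_⟩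
    rintro ⟨a, b⟩ ⟨a', b'⟩ hle hm
    have h1 : a' ≤ a := hle.1
    have h2 : b' ≤ b := hle.2
    rw [Finset.mem_coe, Finset.mem_erase, YoungDiagram.mem_cells,
        YoungDiagram.mem_iff_lt_rowLen] at hm ⊢
    obtain ⟨hne, hm⟩ := hm
    have := d.rowLen_anti a' a h1
    refine ⟨?_, by omega⟩
    intro e
    obtain ⟨rfl, rfl⟩ := Prod.mk.inj e
    by_cases e : a = a'
    · subst e
      apply hne
      congr 1
      omega
    · have := d.rowLen_anti (a' + 1) a (by omega)
      omega

theorem rowLen_colLen (d : YoungDiagram) (i j : ℕ) : j < d.rowLen i ↔ i < d.colLen j := by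
  rw [← YoungDiagram.mem_iff_lt_rowLen, ← YoungDiagram.mem_iff_lt_colLen]

theorem prod_addables (d : YoungDiagram) (f : ℕ → ℕ → K) :
    ∏ c ∈ addables d, f c.1 c.2 = (∏ i ∈ Finset.range (d.colLen 0),
      if d.rowLen (i + 1) < d.rowLen i then f (i + 1) (d.rowLen (i + 1)) else 1)
        * f 0 (d.rowLen 0) := by
  classical
  have h : addables d = ((Finset.range (d.colLen 0 + 1)).filter
      (fun i => i = 0 ∨ d.rowLen i < d.rowLen (i - 1))).image (fun i => (i, d.rowLen i)) := by
    ext ⟨i, j⟩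
    simp only [addables, Finset.mem_filter, Finset.mem_product, Finset.mem_range,
      isAddable_iff, Finset.mem_image, Prod.mk.injEq]
    have := d.rowLen_anti 0 i (by omega)
    constructor
    · rintro ⟨⟨h1, h2⟩, h3, h4⟩
      exact ⟨i, ⟨h1, h4⟩, rfl, h3.symm⟩
    · rintro ⟨a, ⟨h1, h2⟩, rfl, rfl⟩
      exact ⟨⟨h1, by omega⟩, rfl, h2⟩
  rw [h, Finset.prod_image (by intro a _ b _ hab; exact (Prod.mk.inj hab).1), Finset.prod_filter,
    Finset.prod_range_succ']
  simp

theorem prod_removables (d : YoungDiagram) (f : ℕ → ℕ → K) :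
    ∏ c ∈ removables d, f (c.1 + 1) (c.2 + 1) = ∏ i ∈ Finset.range (d.colLen 0),
      if d.rowLen (i + 1) < d.rowLen i then f (i + 1) (d.rowLen i) else 1 := by
  classical
  have h : removables d = ((Finset.range (d.colLen 0)).filter
      (fun i => d.rowLen (i + 1) < d.rowLen i)).image (fun i => (i, d.rowLen i - 1)) := by
    ext ⟨i, j⟩
    simp only [removables, Finset.mem_filter, YoungDiagram.mem_cells, Finset.mem_range,
      isRemovable_iff, Finset.mem_image, Prod.mk.injEq, YoungDiagram.mem_iff_lt_rowLen]
    constructor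
    · rintro ⟨h1, h3, h4⟩
      exact ⟨i, ⟨by rw [← rowLen_colLen]; omega, h4⟩, rfl, by omega⟩
    · rintro ⟨a, ⟨h1, h2⟩, rfl, rfl⟩
      omega
  rw [h, Finset.prod_image (by intro a _ b _ hab; exact (Prod.mk.inj hab).1), Finset.prod_filter]
  apply Finset.prod_congr rfl
  intro i _
  split_ifs with hh
  · congr 1
    simp only
    omega
  · rfl

/-- Truncated path product. -/
def Fp (d : YoungDiagram) (f : ℕ → ℕ → K) (r : ℕ) : K :=
  (f 0 (d.rowLen 0) * ∏ i ∈ Finset.range r, f (i + 1) (d.rowLen (i + 1)) / f (i + 1) (d.rowLen i)) *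
    ∏ j ∈ Finset.range (d.rowLen r), f (d.colLen j) j / f (d.colLen j) (j + 1)

theorem tele (g : ℕ → K) (hg : ∀ j, g j ≠ 0) (a n : ℕ) :
    ∏ j ∈ Finset.range n, g (a + j) / g (a + j + 1) = g a / g (a + n) := by
  induction n with
  | zero => simp [hg]
  | succ n ih =>
    rw [Finset.prod_range_succ, ih]
    have := hg (a + n)
    have := hg (a + n + 1)
    rw [← add_assoc]
    field_simp

theorem Fp_succ (d : YoungDiagram) (f : ℕ → ℕ → K) (hf : ∀ i j, f i j ≠ 0) (r : ℕ) :
    Fp d f (r + 1) = Fp d f r := by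
  unfold Fp
  have hle := d.rowLen_anti r (r + 1) (by omega)
  obtain ⟨n, hn⟩ := Nat.exists_eq_add_of_le hle
  rw [Finset.prod_range_succ]
  have e : ∏ j ∈ Finset.range (d.rowLen r), f (d.colLen j) j / f (d.colLen j) (j + 1)
      = (∏ j ∈ Finset.range (d.rowLen (r + 1)), f (d.colLen j) j / f (d.colLen j) (j + 1)) *
        (f (r + 1) (d.rowLen (r + 1)) / f (r + 1) (d.rowLen r)) := by
    rw [hn, Finset.prod_range_add, ← tele (f (r + 1)) (hf _)]
    congr 1
    apply Finset.prod_congr rfl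
    intro j hj
    rw [Finset.mem_range] at hj
    have h1 := rowLen_colLen d r (d.rowLen (r + 1) + j)
    have h2 := rowLen_colLen d (r + 1) (d.rowLen (r + 1) + j)
    have : d.colLen (d.rowLen (r + 1) + j) = r + 1 := by omega
    rw [this]
  rw [e]
  ring

theorem Fp_eq (d : YoungDiagram) (f : ℕ → ℕ → K) (hf : ∀ i j, f i j ≠ 0) (r : ℕ) :
    Fp d f r = (∏ c ∈ addables d, f c.1 c.2) / ∏ c ∈ removables d, f (c.1 + 1) (c.2 + 1) := by
  have h0 : ∀ r, Fp d f r = Fp d f 0 := by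
    intro r
    induction r with
    | zero => rfl
    | succ n ih => rw [Fp_succ d f hf, ih]
  rw [h0 r, ← h0 (d.colLen 0), prod_addables, prod_removables, mul_div_right_comm,
    ← Finset.prod_div_distrib]
  unfold Fp
  have h1 := rowLen_colLen d (d.colLen 0) 0
  have : d.rowLen (d.colLen 0) = 0 := by omega
  rw [this, Finset.prod_range_zero, mul_one, mul_comm]
  congr 1
  apply Finset.prod_congr rfl
  intro i _
  have hle := d.rowLen_anti i (i + 1) (by omega)
  split_ifs with h
  · rfl
  · rw [show d.rowLen (i + 1) = d.rowLen i by omega, div_self (hf _ _), div_self one_ne_zero]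

theorem colprod (d : YoungDiagram) (s : ℕ) (g g' : ℕ × ℕ → K) (hg : ∀ c, g c ≠ 0)
    (h : ∀ c ∈ d.cells, c.2 ≠ s → g' c = g c) :
    ∏ c ∈ d.cells, g' c
      = (∏ c ∈ d.cells, g c) * ∏ i ∈ Finset.range (d.colLen s), g' (i, s) / g (i, s) := by
  have e : ∏ i ∈ Finset.range (d.colLen s), g' (i, s) / g (i, s) = ∏ c ∈ d.col s, g' c / g c := by
    rw [YoungDiagram.col_eq_prod, Finset.prod_product]
    simp
  have e2 : ∏ c ∈ d.col s, g' c / g c = ∏ c ∈ d.cells, g' c / g c := by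
    apply Finset.prod_subset
    · intro c hc
      rw [YoungDiagram.mem_col_iff] at hc
      exact hc.1
    · intro c hc hn
      rw [YoungDiagram.mem_col_iff] at hn
      rw [h c hc (fun e => hn ⟨hc, e⟩), div_self (hg c)]
  rw [e, e2, ← Finset.prod_mul_distrib]
  apply Finset.prod_congr rfl
  intro c _
  rw [mul_div_cancel₀ _ (hg c)]

theorem rowprod (d : YoungDiagram) (r : ℕ) (g g' : ℕ × ℕ → K) (hg : ∀ c, g c ≠ 0)
    (h : ∀ c ∈ d.cells, c.1 ≠ r → g' c = g c) :
    ∏ c ∈ d.cells, g' c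
      = (∏ c ∈ d.cells, g c) * ∏ j ∈ Finset.range (d.rowLen r), g' (r, j) / g (r, j) := by
  have e : ∏ i ∈ Finset.range (d.rowLen r), g' (r, i) / g (r, i) = ∏ c ∈ d.row r, g' c / g c := by
    rw [YoungDiagram.row_eq_prod, Finset.prod_product]
    simp
  have e2 : ∏ c ∈ d.row r, g' c / g c = ∏ c ∈ d.cells, g' c / g c := by
    apply Finset.prod_subset
    · intro c hc
      rw [YoungDiagram.mem_row_iff] at hc
      exact hc.1
    · intro c hc hn
      rw [YoungDiagram.mem_row_iff] at hn
      rw [h c hc (fun e => hn ⟨hc, e⟩), div_self (hg c)]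
  rw [e, e2, ← Finset.prod_mul_distrib]
  apply Finset.prod_congr rfl
  intro c _
  rw [mul_div_cancel₀ _ (hg c)]

theorem rowLen_addCell (d : YoungDiagram) (r s : ℕ) (h : IsAddable d (r, s)) (i : ℕ) :
    (addCell d (r, s) h.2).rowLen i = if i = r then s + 1 else d.rowLen i := by
  have hs := ((isAddable_iff d r s).1 h).1
  apply eq_of_forall_lt_iff
  intro j
  rw [← YoungDiagram.mem_iff_lt_rowLen, ← YoungDiagram.mem_cells]
  simp only [addCell, Finset.mem_insert, YoungDiagram.mem_cells, Prod.mk.injEq,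
    YoungDiagram.mem_iff_lt_rowLen]
  split_ifs with e
  · subst e
    omega
  · simp [e]

theorem colLen_of_addable (d : YoungDiagram) (r s : ℕ) (h : IsAddable d (r, s)) :
    d.colLen s = r := by
  obtain ⟨hs, hr⟩ := (isAddable_iff d r s).1 h
  have h1 := rowLen_colLen d r s
  have h2 := rowLen_colLen d (r - 1) s
  omega

theorem colLen_addCell (d : YoungDiagram) (r s : ℕ) (h : IsAddable d (r, s)) (j : ℕ) :
    (addCell d (r, s) h.2).colLen j = if j = s then r + 1 else d.colLen j := by
  have hs := colLen_of_addable d r s h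
  apply eq_of_forall_lt_iff
  intro i
  rw [← YoungDiagram.mem_iff_lt_colLen, ← YoungDiagram.mem_cells]
  simp only [addCell, Finset.mem_insert, YoungDiagram.mem_cells, Prod.mk.injEq,
    YoungDiagram.mem_iff_lt_colLen]
  split_ifs with e
  · subst e
    omega
  · simp [e]

theorem shiftprod (f : ℕ → K) (g : ℕ → K) (r : ℕ) :
    f r * ∏ i ∈ Finset.range r, f i / g i = f 0 * ∏ i ∈ Finset.range r, f (i + 1) / g i := by
  rw [Finset.prod_div_distrib, Finset.prod_div_distrib, ← mul_div_assoc, ← mul_div_assoc,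
    mul_comm, ← Finset.prod_range_succ, Finset.prod_range_succ', mul_comm]


theorem nek_add_mu (lam mu : YoungDiagram) (r s : ℕ) (h : IsAddable mu (r, s)) :
    nek lam (addCell mu (r, s) h.2) z = nek lam mu z *
      Fp lam (fun i j => 1 - z * q1 ^ ((i : ℤ) - r) * q2 ^ ((j : ℤ) - s)) r := by
  have hs := ((isAddable_iff mu r s).1 h).1
  have hr := colLen_of_addable mu r s h
  have hR := rowLen_addCell mu r s h
  have hC := colLen_addCell mu r s h
  have hcells : (addCell mu (r, s) h.2).cells = insert (r, s) mu.cells := rfl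
  generalize addCell mu (r, s) h.2 = nu at hR hC hcells ⊢
  unfold nek Fp
  rw [← shiftprod (fun i => 1 - z * q1 ^ ((i : ℤ) - r) * q2 ^ ((lam.rowLen i : ℤ) - s))
    (fun i => 1 - z * q1 ^ (((i + 1 : ℕ) : ℤ) - r) * q2 ^ ((lam.rowLen i : ℤ) - s))]
  simp only [hR, hC]
  rw [hcells, Finset.prod_insert h.1]
  rw [rowprod lam r (fun c => 1 - z * q1 ^ ((lam.colLen c.2 : ℤ) - (c.1 : ℤ)) *
        q2 ^ ((c.2 : ℤ) + 1 - (mu.rowLen c.1 : ℤ))) _ (fun _ => zne _ _)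
        (by intro c _ hc; simp only [if_neg hc]),
    colprod mu s (fun c => 1 - z * q1 ^ ((c.1 : ℤ) + 1 - (mu.colLen c.2 : ℤ)) *
        q2 ^ ((lam.rowLen c.1 : ℤ) - (c.2 : ℤ))) _ (fun _ => zne _ _)
        (by intro c _ hc; simp only [if_neg hc])]
  simp only [if_true, hr, ← hs]
  have e1 : ∏ j ∈ Finset.range (lam.rowLen r),
      (1 - z * q1 ^ ((lam.colLen j : ℤ) - r) * q2 ^ ((j : ℤ) + 1 - ((s + 1 : ℕ) : ℤ))) /
        (1 - z * q1 ^ ((lam.colLen j : ℤ) - r) * q2 ^ ((j : ℤ) + 1 - s)) =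
      ∏ j ∈ Finset.range (lam.rowLen r),
      (1 - z * q1 ^ ((lam.colLen j : ℤ) - r) * q2 ^ ((j : ℤ) - s)) /
        (1 - z * q1 ^ ((lam.colLen j : ℤ) - r) * q2 ^ (((j + 1 : ℕ) : ℤ) - s)) := by
    apply Finset.prod_congr rfl
    intro j _
    push_cast
    rw [show (j : ℤ) + 1 - (s + 1) = j - s by ring]
  have e2 : ∏ i ∈ Finset.range r,
      (1 - z * q1 ^ ((i : ℤ) + 1 - ((r + 1 : ℕ) : ℤ)) * q2 ^ ((lam.rowLen i : ℤ) - s)) /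
        (1 - z * q1 ^ ((i : ℤ) + 1 - r) * q2 ^ ((lam.rowLen i : ℤ) - s)) =
      ∏ i ∈ Finset.range r,
      (1 - z * q1 ^ ((i : ℤ) - r) * q2 ^ ((lam.rowLen i : ℤ) - s)) /
        (1 - z * q1 ^ (((i + 1 : ℕ) : ℤ) - r) * q2 ^ ((lam.rowLen i : ℤ) - s)) := by
    apply Finset.prod_congr rfl
    intro j _
    push_cast
    rw [show (j : ℤ) + 1 - (r + 1) = j - r by ring]
  rw [e1, e2, show (r : ℤ) + 1 - ((r + 1 : ℕ) : ℤ) = r - r by push_cast; ring]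
  ring

theorem nek_add_lam (lam mu : YoungDiagram) (r s : ℕ) (h : IsAddable lam (r, s)) :
    nek (addCell lam (r, s) h.2) mu z = nek lam mu z *
      Fp mu (fun i j => 1 - z * q1 ^ ((r : ℤ) + 1 - i) * q2 ^ ((s : ℤ) + 1 - j)) r := by
  have hs := ((isAddable_iff lam r s).1 h).1
  have hr := colLen_of_addable lam r s h
  have hR := rowLen_addCell lam r s h
  have hC := colLen_addCell lam r s h
  have hcells : (addCell lam (r, s) h.2).cells = insert (r, s) lam.cells := rfl
  generalize addCell lam (r, s) h.2 = nu at hR hC hcells ⊢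
  unfold nek Fp
  rw [← shiftprod (fun i => 1 - z * q1 ^ ((r : ℤ) + 1 - i) * q2 ^ ((s : ℤ) + 1 - mu.rowLen i))
    (fun i => 1 - z * q1 ^ ((r : ℤ) + 1 - ((i + 1 : ℕ) : ℤ)) * q2 ^ ((s : ℤ) + 1 - mu.rowLen i))]
  simp only [hR, hC]
  rw [hcells, Finset.prod_insert h.1]
  rw [colprod lam s (fun c => 1 - z * q1 ^ ((lam.colLen c.2 : ℤ) - (c.1 : ℤ)) *
        q2 ^ ((c.2 : ℤ) + 1 - (mu.rowLen c.1 : ℤ))) _ (fun _ => zne _ _)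
        (by intro c _ hc; simp only [if_neg hc]),
    rowprod mu r (fun c => 1 - z * q1 ^ ((c.1 : ℤ) + 1 - (mu.colLen c.2 : ℤ)) *
        q2 ^ ((lam.rowLen c.1 : ℤ) - (c.2 : ℤ))) _ (fun _ => zne _ _)
        (by intro c _ hc; simp only [if_neg hc])]
  simp only [if_true, hr, ← hs]
  push_cast
  simp only [add_sub_add_right_eq_sub]
  ring

theorem part2 (lam mu : YoungDiagram) (r s : ℕ) (h : IsAddable mu (r, s)) :
    nekT lam (addCell mu (r, s) h.2) z = Ycal lam (chi (r, s) / z) * nekT lam mu z := by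
  have h1 := q1ne
  have h2 := q2ne
  have h3 := zne0
  have e : Ycal lam (chi (r, s) / z) =
      Fp lam (fun i j => 1 - z * q1 ^ ((i : ℤ) - r) * q2 ^ ((j : ℤ) - s)) r := by
    rw [Fp_eq _ _ (fun _ _ => zne _ _)]
    unfold Ycal
    congr 1
    · apply Finset.prod_congr rfl
      intro c _
      rw [zpow_sub₀ h1, zpow_sub₀ h2]
      simp only [zpow_natCast, chi]
      field_simp
    · apply Finset.prod_congr rfl
      intro c _
      rw [zpow_sub₀ h1, zpow_sub₀ h2]
      simp only [zpow_natCast, chi, q3]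
      field_simp
      ring
  unfold nekT
  rw [nek_add_mu lam mu r s h, e]
  ring

theorem Fp_mul (d : YoungDiagram) (f g : ℕ → ℕ → K) (r : ℕ) :
    Fp d (fun i j => f i j * g i j) r = Fp d f r * Fp d g r := by
  unfold Fp
  simp only [Finset.prod_div_distrib, Finset.prod_mul_distrib]
  simp only [div_eq_mul_inv, mul_inv]
  ring

theorem Fp_mono (d : YoungDiagram) (x : K) (hx : x ≠ 0) (r : ℕ) :
    Fp d (fun i j => x * (q1 ^ i * q2 ^ j)) r = x := by
  have h1 := q1ne
  have h2 := q2ne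
  induction r with
  | zero =>
    unfold Fp
    have : ∀ j, x * (q1 ^ d.colLen j * q2 ^ j) / (x * (q1 ^ d.colLen j * q2 ^ (j + 1)))
        = q2⁻¹ := by
      intro j
      field_simp
      ring
    simp only [this]
    simp
    field_simp
  | succ n ih =>
    rw [Fp_succ, ih]
    intro i j
    positivity

theorem part1 (lam mu : YoungDiagram) (r s : ℕ) (h : IsAddable lam (r, s)) :
    nekT (addCell lam (r, s) h.2) mu z = Ycal mu (q3⁻¹ * z * chi (r, s)) * nekT lam mu z := by
  have h1 := q1ne
  have h2 := q2ne
  have h3 := zne0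
  have hq : q3 ≠ 0 := by unfold q3; positivity
  have hx : (-q3⁻¹ * z * chi (r, s))⁻¹ ≠ 0 := by
    apply inv_ne_zero
    unfold chi
    simp [h1, h2, h3, hq]
  have e : Ycal mu (q3⁻¹ * z * chi (r, s)) =
      Fp mu (fun i j => 1 - z * q1 ^ ((r : ℤ) + 1 - i) * q2 ^ ((s : ℤ) + 1 - j)) r *
        (-q3⁻¹ * z * chi (r, s))⁻¹ := by
    rw [← Fp_mono mu _ hx r, ← Fp_mul, Fp_eq]
    · unfold Ycal
      congr 1
      · apply Finset.prod_congr rfl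
        intro c _
        rw [zpow_sub₀ h1, zpow_sub₀ h2, zpow_add₀ h1, zpow_add₀ h2]
        simp only [zpow_natCast, zpow_one, chi, q3, inv_inv, neg_mul, inv_neg]
        field_simp
        ring
      · apply Finset.prod_congr rfl
        intro c _
        rw [zpow_sub₀ h1, zpow_sub₀ h2, zpow_add₀ h1, zpow_add₀ h2]
        simp only [zpow_natCast, zpow_one, chi, q3, inv_inv, neg_mul, inv_neg]
        field_simp
        ring
    · intro i j
      exact mul_ne_zero (zne _ _) (mul_ne_zero hx (by positivity))
  unfold nekT
  rw [nek_add_lam lam mu r s h, e, show (addCell lam (r, s) h.2).cells = insert (r, s) lam.cells from rfl,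
    Finset.prod_insert h.1, mul_inv]
  ring

/-- For all partitions `λ, μ`, in `ℚ(q1,q2,z)`: if `c` is an addable cell of `λ` then
`Ñ_{λ∪{c},μ}(z) = Y_μ(q3⁻¹ z χ_c) · Ñ_{λ,μ}(z)`, and if `c'` is an addable cell of `μ`
then `Ñ_{λ,μ∪{c'}}(z) = Y_λ(χ_{c'}/z) · Ñ_{λ,μ}(z)`. -/
theorem stmt6 (lam mu : YoungDiagram) :
    (∀ c : ℕ × ℕ, ∀ h : IsAddable lam c,
        nekT (addCell lam c h.2) mu z = Ycal mu (q3⁻¹ * z * chi c) * nekT lam mu z) ∧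
      ∀ c' : ℕ × ℕ, ∀ h : IsAddable mu c',
        nekT lam (addCell mu c' h.2) z = Ycal lam (chi c' / z) * nekT lam mu z := by
  refine ⟨?_, ?_⟩
  · rintro ⟨r, s⟩ h
    exact part1 lam mu r s h
  · rintro ⟨r, s⟩ h
    exact part2 lam mu r s h

end
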